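/- Let i ∈ I, X ∈ Pe([≤i]), and let X' ⊆ X be closed and nonempty with X'↾(<i) = X↾(<i), such that X' satisfies conditions (P-2) and (P-3) for this particular i (i.e., D_{X'z}(i) is perfect for every z ∈ X'↾(<i), and {x↾(<i) : x ∈ X', x(i) ∈ G} is open in X'↾(<i) for every open G ⊆ D). Then X' ∈ Pe([≤i]). -/

import Mathlib

open Set

abbrev Cantor : Type := ℕ → Bool

section
variable {I : Type}

/-- Restriction of a point of `D^η` to `D^ξ` (for `ξ ⊆ η`). -/
def restrictFn {ξ η : Set I} (h : ξ ⊆ η) (x : ↥η → Cantor) : ↥ξ → Cantor :=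
  fun j => x ⟨j.1, h j.2⟩

/-- Projection `X↾ξ` of a set `X ⊆ D^η`. -/
def resSet {ξ η : Set I} (h : ξ ⊆ η) (X : Set (↥η → Cantor)) : Set (↥ξ → Cantor) :=
  restrictFn h '' X

/-- Inverse projection `Y↾⁻¹η` of a set `Y ⊆ D^ξ`. -/
def resPre {ξ η : Set I} (h : ξ ⊆ η) (Y : Set (↥ξ → Cantor)) : Set (↥η → Cantor) :=
  {y | restrictFn h y ∈ Y}

/-- `A` is (relatively) open in `B`. -/
def RelOpen {α : Type*} [TopologicalSpace α] (A B : Set α) : Prop :=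
  ∃ U, IsOpen U ∧ A = U ∩ B

/-- `A` is (relatively) closed in `B`. -/
def RelClosed {α : Type*} [TopologicalSpace α] (A B : Set α) : Prop :=
  ∃ U, IsClosed U ∧ A = U ∩ B

/-- `A` is (relatively) clopen in `B`. -/
def RelClopen {α : Type*} [TopologicalSpace α] (A B : Set α) : Prop :=
  RelOpen A B ∧ RelClosed A B

open Classical in
/-- The union `x ∪ y` of two partial points agreeing on the common domain. -/
noncomputable def glue {ξ η : Set I} (x : ↥ξ → Cantor) (y : ↥η → Cantor) :
    ↥(ξ ∪ η) → Cantor :=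
  fun j => if h : j.1 ∈ ξ then x ⟨j.1, h⟩
           else y ⟨j.1, ((Set.mem_union j.1 ξ η).mp j.2).resolve_left h⟩

variable [PartialOrder I]

/-- `[<i]`. -/
def seg (i : I) : Set I := {j | j < i}

/-- `[≤i]`. -/
def segLe (i : I) : Set I := {j | j ≤ i}

/-- `[≯i]`. -/
def segNG (i : I) : Set I := {j | ¬ i < j}

lemma seg_subset {ζ : Set I} (hζ : IsLowerSet ζ) {i : I} (hi : i ∈ ζ) : seg i ⊆ ζ :=
  fun _ hj => hζ (le_of_lt hj) hi

lemma segLe_subset {ζ : Set I} (hζ : IsLowerSet ζ) {i : I} (hi : i ∈ ζ) : segLe i ⊆ ζ :=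
  fun _ hj => hζ hj hi

lemma isLowerSet_segLe (i : I) : IsLowerSet (segLe i) :=
  fun _ _ hba ha => le_trans hba ha

lemma seg_subset_segLe (i : I) : seg i ⊆ segLe i :=
  fun _ hj => le_of_lt hj

lemma mem_segLe_self (i : I) : i ∈ segLe i := le_refl i

/-- `D_{Xz}(i) = {x(i) : x ∈ X, x↾(<i) = z}`. -/
def Dxz {ζ : Set I} (X : Set (↥ζ → Cantor)) {i : I} (hi : i ∈ ζ) (h : seg i ⊆ ζ)
    (z : ↥(seg i) → Cantor) : Set Cantor :=
  {c | ∃ x ∈ X, restrictFn h x = z ∧ x ⟨i, hi⟩ = c}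

/-- Pre-conditions `IPe(ζ)`. -/
def IPe (ζ : Set I) (hζ : IsLowerSet ζ) (X : Set (↥ζ → Cantor)) : Prop :=
  -- P-1
  (IsClosed X ∧ X.Nonempty) ∧
  -- P-2
  (∀ (i : I) (hi : i ∈ ζ), ∀ z ∈ resSet (seg_subset hζ hi) X,
      Perfect (Dxz X hi (seg_subset hζ hi) z)) ∧
  -- P-3
  (∀ (i : I) (hi : i ∈ ζ), ∀ G : Set Cantor, IsOpen G →
      RelOpen
        ({z | ∃ x ∈ X, x ⟨i, hi⟩ ∈ G ∧ restrictFn (seg_subset hζ hi) x = z} :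
          Set (↥(seg i) → Cantor))
        (resSet (seg_subset hζ hi) X)) ∧
  -- P-4
  (∀ ξ η : Set I, IsLowerSet ξ → IsLowerSet η → ∀ (hξ : ξ ⊆ ζ) (hη : η ⊆ ζ),
      ∀ x ∈ resSet hξ X, ∀ y ∈ resSet hη X,
        restrictFn (Set.inter_subset_left : ξ ∩ η ⊆ ξ) x =
          restrictFn (Set.inter_subset_right : ξ ∩ η ⊆ η) y →
        glue x y ∈ resSet (Set.union_subset hξ hη) X)

/-- `stem(A)`: the length of the longest common initial segment of members of `A`. -/
noncomputable def stem (A : Set Cantor) : ℕ :=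
  sInf {n | ∃ a ∈ A, ∃ b ∈ A, a n ≠ b n}

/-- `Spl(A,e)` for `A ⊆ D`. -/
def SplD (A : Set Cantor) (e : Bool) : Set Cantor :=
  {a ∈ A | a (stem A) = e}

/-- `Spl(X,i,e)` for `X ⊆ D^ζ`. -/
def Spl {ζ : Set I} (hζ : IsLowerSet ζ) (X : Set (↥ζ → Cantor)) {i : I} (hi : i ∈ ζ)
    (e : Bool) : Set (↥ζ → Cantor) :=
  {x ∈ X |
    x ⟨i, hi⟩ ∈
      SplD (Dxz X hi (seg_subset hζ hi) (restrictFn (seg_subset hζ hi) x)) e}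

/-- A `ζ`-admissible function: `Φ : ω → ζ` taking each value of `ζ` infinitely often. -/
def Admissible (ζ : Set I) (Φ : ℕ → I) : Prop :=
  (∀ n, Φ n ∈ ζ) ∧ ∀ i ∈ ζ, ∀ N : ℕ, ∃ n, N ≤ n ∧ Φ n = i

/-- The sets `X_Φ[u]` for finite binary sequences `u`. -/
def XPhi {ζ : Set I} (hζ : IsLowerSet ζ) (Φ : ℕ → I) (hΦ : ∀ n, Φ n ∈ ζ)
    (X : Set (↥ζ → Cantor)) : (m : ℕ) → (Fin m → Bool) → Set (↥ζ → Cantor)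
  | 0, _ => X
  | m + 1, u =>
      Spl hζ (XPhi hζ Φ hΦ X m (fun k => u k.castSucc)) (hΦ m) (u (Fin.last m))

/-- `X` is shrinkable: each `X_Φ[a]` is a singleton. -/
def Shrinkable {ζ : Set I} (hζ : IsLowerSet ζ) (X : Set (↥ζ → Cantor)) : Prop :=
  ∀ (Φ : ℕ → I) (hΦ : Admissible ζ Φ) (a : ℕ → Bool),
    ∃ x, (⋂ m : ℕ, XPhi hζ Φ hΦ.1 X m (fun k => a k.1)) = {x}

/-- Conditions `Pe(ζ)`: shrinkable pre-conditions. -/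
def Pe (ζ : Set I) (hζ : IsLowerSet ζ) (X : Set (↥ζ → Cantor)) : Prop :=
  IPe ζ hζ X ∧ Shrinkable hζ X

/-- `Perf = Pe(I)`. -/
def Perf (X : Set (↥(Set.univ : Set I) → Cantor)) : Prop :=
  Pe Set.univ isLowerSet_univ X

/-- The initial segments `ξ[u,v]`. -/
def xiUV (Φ : ℕ → I) : (m : ℕ) → (Fin m → Bool) → (Fin m → Bool) → Set I
  | 0, _, _ => Set.univ
  | m + 1, u, v =>
      if u (Fin.last m) = v (Fin.last m) then
        xiUV Φ m (fun k => u k.castSucc) (fun k => v k.castSucc)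
      else
        xiUV Φ m (fun k => u k.castSucc) (fun k => v k.castSucc) ∩ segNG (Φ m)

/-- A `Φ`-splitting system of order `m`. -/
def SplittingSystem (Φ : ℕ → I) (m : ℕ)
    (X : (n : ℕ) → (Fin n → Bool) → Set (↥(Set.univ : Set I) → Cantor)) : Prop :=
  (∀ n, n ≤ m → ∀ u : Fin n → Bool, Perf (X n u)) ∧
  -- S-1
  (∀ n, n < m → ∀ (u : Fin n → Bool) (e : Bool),
      X (n + 1) (Fin.snoc u e) ⊆
        Spl isLowerSet_univ (X n u) (Set.mem_univ (Φ n)) e) ∧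
  -- S-2
  (∀ n, n ≤ m → ∀ u v : Fin n → Bool,
      resSet (Set.subset_univ (xiUV Φ n u v)) (X n u) =
        resSet (Set.subset_univ (xiUV Φ n u v)) (X n v)) ∧
  -- S-3
  (∀ n, n ≤ m → ∀ u v : Fin n → Bool, ∀ i : I, i ∉ xiUV Φ n u v →
      resSet (Set.subset_univ (segLe i)) (X n u) ∩
        resSet (Set.subset_univ (segLe i)) (X n v) = ∅)

/-- `F` is reducible to `ξ` on `X`. -/
def Reducible {β : Type*} (F : (↥(Set.univ : Set I) → Cantor) → β) (ξ : Set I)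
    (X : Set (↥(Set.univ : Set I) → Cantor)) : Prop :=
  ∀ x ∈ X, ∀ y ∈ X,
    restrictFn (Set.subset_univ ξ) x = restrictFn (Set.subset_univ ξ) y → F x = F y

/-- `F` captures `i` on `X`. -/
def Captures {β : Type*} (F : (↥(Set.univ : Set I) → Cantor) → β) (i : I)
    (X : Set (↥(Set.univ : Set I) → Cantor)) : Prop :=
  ∀ x ∈ X, ∀ y ∈ X, F x = F y → x ⟨i, Set.mem_univ i⟩ = y ⟨i, Set.mem_univ i⟩

/-- Borel sets of finite level: level `0` = closed sets, level `n+1` = countable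
unions or countable intersections of sets of level `n`. -/
def BorelLevel {α : Type*} [TopologicalSpace α] : ℕ → Set (Set α)
  | 0 => {C | IsClosed C}
  | n + 1 =>
      {S | (∃ f : ℕ → Set α, (∀ k, f k ∈ BorelLevel n) ∧ S = ⋃ k, f k) ∨
           (∃ f : ℕ → Set α, (∀ k, f k ∈ BorelLevel n) ∧ S = ⋂ k, f k)}

end

/-- A nonempty perfect set has two points that differ at its stem. -/
lemma stem_mem_of_perfect {A : Set Cantor} (hA : Perfect A) (hne : A.Nonempty) :
    stem A ∈ {n | ∃ a ∈ A, ∃ b ∈ A, a n ≠ b n} := by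
  apply Nat.sInf_mem
  obtain ⟨a, ha⟩ := hne
  obtain ⟨b, ⟨-, hb⟩, hba⟩ := accPt_iff_nhds.mp (hA.acc a ha) univ Filter.univ_mem
  obtain ⟨n, hn⟩ := Function.ne_iff.mp hba
  exact ⟨n, b, hb, a, ha, hn⟩

lemma eq_of_lt_stem {A : Set Cantor} {n : ℕ} (hn : n < stem A) {a b : Cantor}
    (ha : a ∈ A) (hb : b ∈ A) : a n = b n := by
  by_contra h
  exact Nat.notMem_of_lt_sInf hn ⟨a, ha, b, hb, h⟩

lemma SplD_nonempty {A : Set Cantor} (hA : Perfect A) (hne : A.Nonempty) (e : Bool) :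
    (SplD A e).Nonempty := by
  obtain ⟨a, ha, b, hb, hab⟩ := stem_mem_of_perfect hA hne
  by_cases h : a (stem A) = e
  · exact ⟨a, ha, h⟩
  · refine ⟨b, hb, ?_⟩
    revert hab h
    cases a (stem A) <;> cases b (stem A) <;> cases e <;> simp

lemma SplD_perfect {A : Set Cantor} (hA : Perfect A) (e : Bool) : Perfect (SplD A e) := by
  have hcl : IsClopen {c : Cantor | c (stem A) = e} :=
    (isClopen_discrete ({e} : Set Bool)).preimage (continuous_apply (stem A))
  have heq : SplD A e = {c : Cantor | c (stem A) = e} ∩ A := by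
    ext c
    exact and_comm
  rw [heq]
  exact ⟨hcl.1.inter hA.closed, hA.acc.open_inter hcl.2⟩

section
variable {I : Type}

open Classical in
/-- Iterated splitting of `A ⊆ D` along `a`, carried out only at the stages where `Φ` is `i`. -/
noncomputable def splIter (Φ : ℕ → I) (i : I) (a : ℕ → Bool) (A : Set Cantor) :
    ℕ → Set Cantor
  | 0 => A
  | m + 1 => if Φ m = i then SplD (splIter Φ i a A m) (a m) else splIter Φ i a A m

variable {Φ : ℕ → I} {i : I} {a : ℕ → Bool} {A : Set Cantor}

lemma splIter_antitone : Antitone (splIter Φ i a A) := by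
  refine antitone_nat_of_succ_le fun m => ?_
  rw [splIter]
  split_ifs
  · exact sep_subset _ _
  · exact le_rfl

lemma splIter_perfect_nonempty (hA : Perfect A) (hne : A.Nonempty) (m : ℕ) :
    Perfect (splIter Φ i a A m) ∧ (splIter Φ i a A m).Nonempty := by
  induction m with
  | zero => exact ⟨hA, hne⟩
  | succ m ih =>
    rw [splIter]
    split_ifs
    · exact ⟨SplD_perfect ih.1 _, SplD_nonempty ih.1 ih.2 _⟩
    · exact ih

lemma iInter_splIter_nonempty (hA : Perfect A) (hne : A.Nonempty) :
    (⋂ m, splIter Φ i a A m).Nonempty :=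
  IsCompact.nonempty_iInter_of_sequence_nonempty_isCompact_isClosed _
    (fun m => splIter_antitone (Nat.le_succ m))
    (fun m => (splIter_perfect_nonempty hA hne m).2)
    (splIter_perfect_nonempty hA hne 0).1.closed.isCompact
    (fun m => (splIter_perfect_nonempty hA hne m).1.closed)

lemma exists_splIter_agree_below (hΦ : ∀ N, ∃ n, N ≤ n ∧ Φ n = i) (hA : Perfect A)
    (hne : A.Nonempty) (k : ℕ) :
    ∃ m, ∀ c ∈ splIter Φ i a A m, ∀ d ∈ splIter Φ i a A m, ∀ l < k, c l = d l := by
  induction k with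
  | zero => exact ⟨0, by simp⟩
  | succ k ih =>
    obtain ⟨m, hm⟩ := ih
    obtain ⟨n, hmn, hn⟩ := hΦ m
    have hp := splIter_perfect_nonempty (Φ := Φ) (i := i) (a := a) hA hne n
    have hk : k ≤ stem (splIter Φ i a A n) := by
      obtain ⟨c, hc, d, hd, hcd⟩ := stem_mem_of_perfect hp.1 hp.2
      by_contra! h
      exact hcd (hm c (splIter_antitone hmn hc) d (splIter_antitone hmn hd) _ h)
    refine ⟨n + 1, fun c hc d hd l hl => ?_⟩
    rw [splIter, if_pos hn] at hc hd
    rcases (show l ≤ stem (splIter Φ i a A n) by omega).lt_or_eq with h | h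
    · exact eq_of_lt_stem h hc.1 hd.1
    · rw [h, hc.2, hd.2]

lemma iInter_splIter_subsingleton (hΦ : ∀ N, ∃ n, N ≤ n ∧ Φ n = i) (hA : Perfect A)
    (hne : A.Nonempty) : (⋂ m, splIter Φ i a A m).Subsingleton := by
  intro c hc d hd
  ext l
  obtain ⟨m, hm⟩ := exists_splIter_agree_below (a := a) hΦ hA hne (l + 1)
  rw [hm c (mem_iInter.mp hc m) d (mem_iInter.mp hd m) l (Nat.lt_succ_self l)]

lemma resSet_resSet {ξ η ζ : Set I} (h : ξ ⊆ η) (h' : η ⊆ ζ) (X : Set (↥ζ → Cantor)) :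
    resSet h (resSet h' X) = resSet (h.trans h') X :=
  image_image _ _ _

variable [PartialOrder I]

lemma isLowerSet_seg (i : I) : IsLowerSet (seg i) :=
  fun _ _ hba ha => lt_of_le_of_lt hba ha

/-- The sets `D_{Xz}(j)` depend only on the projection of `X` to an initial segment
containing `j`. -/
lemma Dxz_resSet {ξ ζ : Set I} (h : ξ ⊆ ζ) (X : Set (↥ζ → Cantor)) {j : I} (hj : j ∈ ξ)
    (hs : seg j ⊆ ξ) (z : ↥(seg j) → Cantor) :
    Dxz (resSet h X) hj hs z = Dxz X (h hj) (hs.trans h) z := by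
  ext c
  constructor
  · rintro ⟨_, ⟨x, hx, rfl⟩, hz, hc⟩
    exact ⟨x, hx, hz, hc⟩
  · rintro ⟨x, hx, hz, hc⟩
    exact ⟨_, ⟨x, hx, rfl⟩, hz, hc⟩

lemma mem_Spl_iff_resSet {ξ ζ : Set I} (hξ : IsLowerSet ξ) (hζ : IsLowerSet ζ) (h : ξ ⊆ ζ)
    (X : Set (↥ζ → Cantor)) {j : I} (hj : j ∈ ξ) (e : Bool) (x : ↥ζ → Cantor) :
    x ∈ Spl hζ X (h hj) e ↔ x ∈ X ∧ restrictFn h x ∈ Spl hξ (resSet h X) hj e := by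
  simp only [Spl, mem_ofPred_eq, Dxz_resSet]
  exact ⟨fun hx => ⟨hx.1, ⟨x, hx.1, rfl⟩, hx.2⟩, fun hx => ⟨hx.1, hx.2.2⟩⟩

open Classical in
/-- Iterated splitting of `B ⊆ D^[<i]` along `a`, ignoring the stages where `Φ` leaves `[<i]`. -/
noncomputable def baseIter (Φ : ℕ → I) (i : I) (a : ℕ → Bool) (B : Set (↥(seg i) → Cantor)) :
    ℕ → Set (↥(seg i) → Cantor)
  | 0 => B
  | m + 1 =>
      if h : Φ m ∈ seg i then Spl (isLowerSet_seg i) (baseIter Φ i a B m) h (a m)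
      else baseIter Φ i a B m

lemma baseIter_subset {B : Set (↥(seg i) → Cantor)} (m : ℕ) : baseIter Φ i a B m ⊆ B := by
  induction m with
  | zero => exact subset_rfl
  | succ m ih =>
    rw [baseIter]
    split_ifs
    · exact (sep_subset _ _).trans ih
    · exact ih

/-- Splitting of `X ⊆ D^[≤i]` acts separately on the projection to `[<i]` and on the fibers. -/
lemma mem_XPhi_iff {X : Set (↥(segLe i) → Cantor)}
    (hP2 : ∀ z ∈ resSet (seg_subset_segLe i) X,
      Perfect (Dxz X (mem_segLe_self i) (seg_subset_segLe i) z))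
    (hΦ : ∀ n, Φ n ∈ segLe i) (m : ℕ) (x : ↥(segLe i) → Cantor) :
    x ∈ XPhi (isLowerSet_segLe i) Φ hΦ X m (fun k => a k.1) ↔
      x ∈ X ∧
      restrictFn (seg_subset_segLe i) x ∈
        baseIter Φ i a (resSet (seg_subset_segLe i) X) m ∧
      x ⟨i, mem_segLe_self i⟩ ∈ splIter Φ i a
        (Dxz X (mem_segLe_self i) (seg_subset_segLe i) (restrictFn (seg_subset_segLe i) x)) m := by
  induction m generalizing x with
  | zero => exact ⟨fun h => ⟨h, ⟨x, h, rfl⟩, ⟨x, h, rfl, rfl⟩⟩, fun h => h.1⟩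
  | succ m ih =>
    change x ∈ Spl (isLowerSet_segLe i)
      (XPhi (isLowerSet_segLe i) Φ hΦ X m (fun k => a k.1)) (hΦ m) (a m) ↔ _
    set Y := XPhi (isLowerSet_segLe i) Φ hΦ X m (fun k => a k.1) with hY
    rw [baseIter, splIter]
    by_cases hm : Φ m = i
    · have hns : Φ m ∉ seg i := fun h => (lt_irrefl i) (hm ▸ h : i < i)
      rw [dif_neg hns, if_pos hm]
      have key : ∀ j (hj : j ∈ segLe i), j = i → (x ∈ Spl (isLowerSet_segLe i) Y hj (a m) ↔
          x ∈ Spl (isLowerSet_segLe i) Y (mem_segLe_self i) (a m)) := by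
        rintro _ _ rfl
        rfl
      rw [key _ _ hm]
      have hD : x ∈ Y → Dxz Y (mem_segLe_self i) (seg_subset_segLe i)
            (restrictFn (seg_subset_segLe i) x) =
          splIter Φ i a (Dxz X (mem_segLe_self i) (seg_subset_segLe i)
            (restrictFn (seg_subset_segLe i) x)) m := by
        intro hx
        ext c
        constructor
        · rintro ⟨w, hw, hwx, rfl⟩
          rw [← hwx]
          exact ((ih w).mp hw).2.2
        · intro hc
          obtain ⟨w, hw, hwx, rfl⟩ := splIter_antitone (Nat.zero_le m) hc
          refine ⟨w, (ih w).mpr ⟨hw, ?_, ?_⟩, hwx, rfl⟩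
          · rw [hwx]
            exact ((ih x).mp hx).2.1
          · rw [hwx]
            exact hc
      constructor
      · rintro ⟨hx, hs⟩
        rw [hD hx] at hs
        exact ⟨((ih x).mp hx).1, ((ih x).mp hx).2.1, hs⟩
      · rintro ⟨hx, hb, hs⟩
        have hxY : x ∈ Y := (ih x).mpr ⟨hx, hb, hs.1⟩
        refine ⟨hxY, ?_⟩
        rw [hD hxY]
        exact hs
    · have hs : Φ m ∈ seg i := lt_of_le_of_ne (hΦ m) hm
      rw [dif_pos hs, if_neg hm,
        mem_Spl_iff_resSet (isLowerSet_seg i) (isLowerSet_segLe i) (seg_subset_segLe i) Y hs]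
      have hres : resSet (seg_subset_segLe i) Y =
          baseIter Φ i a (resSet (seg_subset_segLe i) X) m := by
        ext z
        constructor
        · rintro ⟨w, hw, rfl⟩
          exact ((ih w).mp hw).2.1
        · intro hz
          have hzX := baseIter_subset m hz
          have hne : (Dxz X (mem_segLe_self i) (seg_subset_segLe i) z).Nonempty := by
            obtain ⟨w, hw, hwz⟩ := hzX
            exact ⟨_, w, hw, hwz, rfl⟩
          obtain ⟨c, hc⟩ := (splIter_perfect_nonempty (Φ := Φ) (i := i) (a := a)
            (hP2 z hzX) hne m).2
          obtain ⟨w, hw, rfl, rfl⟩ := splIter_antitone (Nat.zero_le m) hc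
          exact ⟨w, (ih w).mpr ⟨hw, hz, hc⟩, rfl⟩
      rw [hres, ih x]
      constructor
      · rintro ⟨⟨hx, -, hf⟩, hb⟩
        exact ⟨hx, hb, hf⟩
      · rintro ⟨hx, hb, hf⟩
        exact ⟨⟨hx, hb.1, hf⟩, hb⟩

/-- Every `z` in all the split projections extends to a point of `X_Φ[a]`. -/
lemma exists_mem_iInter_XPhi {X : Set (↥(segLe i) → Cantor)}
    (hP2 : ∀ z ∈ resSet (seg_subset_segLe i) X,
      Perfect (Dxz X (mem_segLe_self i) (seg_subset_segLe i) z))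
    (hΦ : ∀ n, Φ n ∈ segLe i) {z : ↥(seg i) → Cantor}
    (hz : ∀ m, z ∈ baseIter Φ i a (resSet (seg_subset_segLe i) X) m) :
    ∃ x, (∀ m, x ∈ XPhi (isLowerSet_segLe i) Φ hΦ X m (fun k => a k.1)) ∧
      restrictFn (seg_subset_segLe i) x = z := by
  have hne : (Dxz X (mem_segLe_self i) (seg_subset_segLe i) z).Nonempty := by
    obtain ⟨w, hw, hwz⟩ := hz 0
    exact ⟨_, w, hw, hwz, rfl⟩
  obtain ⟨c, hc⟩ := iInter_splIter_nonempty (Φ := Φ) (i := i) (a := a) (hP2 z (hz 0)) hne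
  rw [mem_iInter] at hc
  obtain ⟨w, hw, rfl, rfl⟩ := hc 0
  exact ⟨w, fun m => (mem_XPhi_iff hP2 hΦ m w).mpr ⟨hw, hz m, hc m⟩, rfl⟩

lemma eq_of_restrictFn_eq {x y : ↥(segLe i) → Cantor}
    (h : restrictFn (seg_subset_segLe i) x = restrictFn (seg_subset_segLe i) y)
    (hi : x ⟨i, mem_segLe_self i⟩ = y ⟨i, mem_segLe_self i⟩) : x = y := by
  funext ⟨j, hj⟩
  rcases (show j ≤ i from hj).lt_or_eq with hlt | rfl
  · exact congrFun h ⟨j, hlt⟩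
  · exact hi

/-- Shrinkability transfers between sets with the same projection to `[<i]` and perfect fibers. -/
lemma Shrinkable.of_resSet_eq {X X' : Set (↥(segLe i) → Cantor)}
    (hX : Shrinkable (isLowerSet_segLe i) X)
    (hres : resSet (seg_subset_segLe i) X' = resSet (seg_subset_segLe i) X)
    (hP2 : ∀ z ∈ resSet (seg_subset_segLe i) X,
      Perfect (Dxz X (mem_segLe_self i) (seg_subset_segLe i) z))
    (hP2' : ∀ z ∈ resSet (seg_subset_segLe i) X',
      Perfect (Dxz X' (mem_segLe_self i) (seg_subset_segLe i) z)) :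
    Shrinkable (isLowerSet_segLe i) X' := by
  intro Φ hΦ a
  obtain ⟨x, hx⟩ := hX Φ hΦ a
  have hxm : ∀ m, x ∈ XPhi (isLowerSet_segLe i) Φ hΦ.1 X m (fun k => a k.1) :=
    mem_iInter.mp (hx ▸ mem_singleton x)
  obtain ⟨y, hy, hyx⟩ := exists_mem_iInter_XPhi (a := a) hP2' hΦ.1
    (z := restrictFn (seg_subset_segLe i) x)
    (fun m => hres ▸ ((mem_XPhi_iff hP2 hΦ.1 m x).mp (hxm m)).2.1)
  refine ⟨y, Subset.antisymm (fun w hw => ?_) (singleton_subset_iff.mpr (mem_iInter.mpr hy))⟩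
  rw [mem_iInter] at hw
  obtain ⟨v, hv, hvw⟩ := exists_mem_iInter_XPhi (a := a) hP2 hΦ.1
    (z := restrictFn (seg_subset_segLe i) w)
    (fun m => hres ▸ ((mem_XPhi_iff hP2' hΦ.1 m w).mp (hw m)).2.1)
  have hvx : v ∈ ({x} : Set _) := hx ▸ mem_iInter.mpr hv
  rw [mem_singleton_iff] at hvx
  have hwy : restrictFn (seg_subset_segLe i) w = restrictFn (seg_subset_segLe i) y := by
    rw [hyx, ← hvw, hvx]
  have hyX : y ∈ X' := hy 0
  refine eq_of_restrictFn_eq hwy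
    (iInter_splIter_subsingleton (a := a) (hΦ.2 i (mem_segLe_self i))
      (hP2' _ ⟨y, hyX, rfl⟩) ⟨_, y, hyX, rfl, rfl⟩ ?_ ?_)
  · rw [← hwy]
    exact mem_iInter.mpr fun m => ((mem_XPhi_iff hP2' hΦ.1 m w).mp (hw m)).2.2
  · exact mem_iInter.mpr fun m => ((mem_XPhi_iff hP2' hΦ.1 m y).mp (hy m)).2.2

/-- Amalgamation (P-4) passes to a subset of `D^[≤i]` with the same projection to `[<i]`. -/
lemma glue_mem_resSet_of_resSet_eq {X X' : Set (↥(segLe i) → Cantor)} (hsub : X' ⊆ X)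
    (hres : resSet (seg_subset_segLe i) X' = resSet (seg_subset_segLe i) X)
    {ξ η : Set I} (hξl : IsLowerSet ξ) (hηl : IsLowerSet η)
    (hξ : ξ ⊆ segLe i) (hη : η ⊆ segLe i) {x : ↥ξ → Cantor} {y : ↥η → Cantor}
    (hglue : x ∈ resSet hξ X → y ∈ resSet hη X → glue x y ∈ resSet (union_subset hξ hη) X)
    (hx : x ∈ resSet hξ X') (hy : y ∈ resSet hη X')
    (hxy : restrictFn (inter_subset_left : ξ ∩ η ⊆ ξ) x =
      restrictFn (inter_subset_right : ξ ∩ η ⊆ η) y) :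
    glue x y ∈ resSet (union_subset hξ hη) X' := by
  by_cases hiξ : i ∈ ξ
  · obtain ⟨w, hw, rfl⟩ := hx
    refine ⟨w, hw, ?_⟩
    funext ⟨j, hj⟩
    have hjξ : j ∈ ξ := hξl (union_subset hξ hη hj) hiξ
    simp [glue, hjξ, restrictFn]
  by_cases hiη : i ∈ η
  · obtain ⟨w, hw, rfl⟩ := hy
    refine ⟨w, hw, ?_⟩
    funext ⟨j, hj⟩
    have hjη : j ∈ η := hηl (union_subset hξ hη hj) hiη
    by_cases hjξ : j ∈ ξ
    · simpa [glue, hjξ, restrictFn] using (congrFun hxy ⟨j, hjξ, hjη⟩).symm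
    · simp [glue, hjξ, restrictFn]
  have hlt : ξ ∪ η ⊆ seg i := fun j hj =>
    lt_of_le_of_ne (union_subset hξ hη hj) fun h => by
      subst h
      exact hj.elim hiξ hiη
  have hmem := hglue (image_mono hsub hx) (image_mono hsub hy)
  rw [← resSet_resSet hlt (seg_subset_segLe i)] at hmem ⊢
  rwa [hres]

end

theorem stmt7 (I : Type) [PartialOrder I] [Countable I]
    (i : I) (X : Set (↥(segLe i) → Cantor))
    (hX : Pe (segLe i) (isLowerSet_segLe i) X)
    (X' : Set (↥(segLe i) → Cantor)) (hsub : X' ⊆ X)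
    (hclosed : IsClosed X') (hne : X'.Nonempty)
    (hres : resSet (seg_subset_segLe i) X' = resSet (seg_subset_segLe i) X)
    (hP2 : ∀ z ∈ resSet (seg_subset_segLe i) X',
      Perfect (Dxz X' (mem_segLe_self i) (seg_subset_segLe i) z))
    (hP3 : ∀ G : Set Cantor, IsOpen G →
      RelOpen
        ({z | ∃ x ∈ X', x ⟨i, mem_segLe_self i⟩ ∈ G ∧
            restrictFn (seg_subset_segLe i) x = z} : Set (↥(seg i) → Cantor))
        (resSet (seg_subset_segLe i) X')) :
    Pe (segLe i) (isLowerSet_segLe i) X' := by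
  obtain ⟨⟨-, hXP2, hXP3, hXP4⟩, hXs⟩ := hX
  have hD : ∀ (j : I) (hj : j ∈ seg i) (z : ↥(seg j) → Cantor),
      Dxz X' (seg_subset_segLe i hj) ((seg_subset (isLowerSet_seg i) hj).trans
        (seg_subset_segLe i)) z =
      Dxz X (seg_subset_segLe i hj) ((seg_subset (isLowerSet_seg i) hj).trans
        (seg_subset_segLe i)) z := by
    intro j hj z
    rw [← Dxz_resSet (seg_subset_segLe i) X' hj (seg_subset (isLowerSet_seg i) hj), hres, Dxz_resSet]
  have hR : ∀ (j : I) (hj : j ∈ seg i),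
      resSet ((seg_subset (isLowerSet_seg i) hj).trans (seg_subset_segLe i)) X' =
      resSet ((seg_subset (isLowerSet_seg i) hj).trans (seg_subset_segLe i)) X := by
    intro j hj
    rw [← resSet_resSet (seg_subset (isLowerSet_seg i) hj) (seg_subset_segLe i), hres,
      resSet_resSet]
  refine ⟨⟨⟨hclosed, hne⟩, ?_, ?_, ?_⟩, hXs.of_resSet_eq hres (hXP2 i (mem_segLe_self i)) hP2⟩
  · intro j hj z hz
    rcases (show j ≤ i from hj).lt_or_eq with hlt | rfl
    · rw [hD j hlt]
      rw [hR j hlt] at hz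
      exact hXP2 j hj z hz
    · exact hP2 z hz
  · intro j hj G hG
    rcases (show j ≤ i from hj).lt_or_eq with hlt | rfl
    · rw [hR j hlt]
      convert hXP3 j hj G hG using 1
      ext z
      constructor
      · rintro ⟨x, hx, hxG, hxz⟩
        exact ⟨x, hsub hx, hxG, hxz⟩
      · rintro ⟨x, hx, hxG, hxz⟩
        obtain ⟨w, hw, hwz, hwx⟩ := (hD j hlt z).ge ⟨x, hx, hxz, rfl⟩
        exact ⟨w, hw, hwx ▸ hxG, hwz⟩
    · exact hP3 G hG
  · intro ξ η hξl hηl hξ hη x hx y hy hxy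
    exact glue_mem_resSet_of_resSet_eq hsub hres hξl hηl hξ hη
      (fun hx hy => hXP4 ξ η hξl hηl hξ hη x hx y hy hxy) hx hy hxy
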